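/- Every vertex-transitive equivelar map of Schläfli type {3,7} that is a 2-orbit map is chiral. -/

import Mathlib

/-- A map: a finite nonempty set of flags with three fixed-point-free involutions
`s0, s1, s2` such that `s0 * s2` is also a fixed-point-free involution and the
group generated by them acts transitively on the flags. -/
structure CMap (F : Type) [Fintype F] where
  nonempty : Nonempty F
  s0 : Equiv.Perm F
  s1 : Equiv.Perm F
  s2 : Equiv.Perm F
  invol0 : s0 * s0 = 1
  invol1 : s1 * s1 = 1
  invol2 : s2 * s2 = 1
  fpf0 : ∀ x, s0 x ≠ x
  fpf1 : ∀ x, s1 x ≠ x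
  fpf2 : ∀ x, s2 x ≠ x
  invol02 : (s0 * s2) * (s0 * s2) = 1
  fpf02 : ∀ x, s0 (s2 x) ≠ x
  conn : ∀ x y : F, ∃ g ∈ Subgroup.closure ({s0, s1, s2} : Set (Equiv.Perm F)), g x = y

namespace CMap

variable {F : Type} [Fintype F]

/-- The automorphism group of a map: all permutations of the flags commuting
with each of `s0, s1, s2`. -/
def aut (M : CMap F) : Subgroup (Equiv.Perm F) :=
  Subgroup.centralizer {M.s0, M.s1, M.s2}

/-- The vertex containing a flag `x`: the orbit of `x` under `⟨s1, s2⟩`. -/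
def vertexOf (M : CMap F) (x : F) : Set F :=
  MulAction.orbit (Subgroup.closure ({M.s1, M.s2} : Set (Equiv.Perm F))) x

/-- The edge containing a flag `x`: the orbit of `x` under `⟨s0, s2⟩`. -/
def edgeOf (M : CMap F) (x : F) : Set F :=
  MulAction.orbit (Subgroup.closure ({M.s0, M.s2} : Set (Equiv.Perm F))) x

/-- The face containing a flag `x`: the orbit of `x` under `⟨s0, s1⟩`. -/
def faceOf (M : CMap F) (x : F) : Set F :=
  MulAction.orbit (Subgroup.closure ({M.s0, M.s1} : Set (Equiv.Perm F))) x

/-- The orbit of a flag under the automorphism group. -/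
def flagOrbit (M : CMap F) (x : F) : Set F :=
  MulAction.orbit M.aut x

noncomputable def numVertices (M : CMap F) : ℕ := Nat.card (Set.range M.vertexOf)

noncomputable def numEdges (M : CMap F) : ℕ := Nat.card (Set.range M.edgeOf)

noncomputable def numFaces (M : CMap F) : ℕ := Nat.card (Set.range M.faceOf)

/-- The Euler characteristic `V - E + F` of a map. -/
noncomputable def euler (M : CMap F) : ℤ :=
  (M.numVertices : ℤ) - (M.numEdges : ℤ) + (M.numFaces : ℤ)

/-- The number of orbits of the automorphism group on flags. -/
noncomputable def numFlagOrbits (M : CMap F) : ℕ := Nat.card (Set.range M.flagOrbit)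

/-- `M` is a `k`-orbit map if its automorphism group has exactly `k` orbits on flags. -/
def IsKOrbit (M : CMap F) (k : ℕ) : Prop := M.numFlagOrbits = k

/-- A map is regular if it is a 1-orbit map. -/
def IsRegular (M : CMap F) : Prop := M.IsKOrbit 1

/-- A map is chiral if it is a 2-orbit map in which every flag lies in a
different automorphism orbit from each of its images under `s0, s1, s2`. -/
def IsChiral (M : CMap F) : Prop :=
  M.IsKOrbit 2 ∧ ∀ x : F,
    M.s0 x ∉ M.flagOrbit x ∧ M.s1 x ∉ M.flagOrbit x ∧ M.s2 x ∉ M.flagOrbit x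

/-- A map is vertex-transitive if its automorphism group acts transitively on vertices. -/
def VertexTransitive (M : CMap F) : Prop :=
  ∀ x y : F, ∃ g ∈ M.aut, M.vertexOf (g x) = M.vertexOf y

/-- A map is edge-transitive if its automorphism group acts transitively on edges. -/
def EdgeTransitive (M : CMap F) : Prop :=
  ∀ x y : F, ∃ g ∈ M.aut, M.edgeOf (g x) = M.edgeOf y

/-- `M` is equivelar of Schläfli type `{p, q}`: every face has exactly `2p` flags
and every vertex has exactly `2q` flags. -/
def Equivelar (M : CMap F) (p q : ℕ) : Prop :=
  (∀ x : F, Nat.card (M.faceOf x) = 2 * p) ∧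
  (∀ x : F, Nat.card (M.vertexOf x) = 2 * q)

/-- A map is orientable if the flags can be partitioned into two classes so that
each of `s0, s1, s2` maps each class into the other. -/
def Orientable (M : CMap F) : Prop :=
  ∃ A : Set F,
    (∀ x, M.s0 x ∈ A ↔ x ∉ A) ∧ (∀ x, M.s1 x ∈ A ↔ x ∉ A) ∧ (∀ x, M.s2 x ∈ A ↔ x ∉ A)

end CMap

/-- Two maps are isomorphic if there is a bijection between their flag sets
commuting with the respective involutions. -/
def CMap.Isomorphic {F F' : Type} [Fintype F] [Fintype F'] (M : CMap F) (N : CMap F') : Prop :=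
  ∃ e : F ≃ F',
    (∀ x, e (M.s0 x) = N.s0 (e x)) ∧ (∀ x, e (M.s1 x) = N.s1 (e x)) ∧
    (∀ x, e (M.s2 x) = N.s2 (e x))

/-- If a fixed-point-free involution `a` preserves a set `A` and a permutation `b` exchanges `A`
with its complement, then any finite set invariant under both has cardinality divisible by `4`. -/
theorem four_dvd_card_of_preserves_of_swaps {F : Type} [Fintype F] (A O : Set F)
    (a b : Equiv.Perm F) (ha : a * a = 1) (hfa : ∀ x, a x ≠ x) (hb : b * b = 1)
    (haO : ∀ x ∈ O, a x ∈ O) (hbO : ∀ x ∈ O, b x ∈ O)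
    (haA : ∀ x, a x ∈ A ↔ x ∈ A) (hbA : ∀ x, b x ∈ A ↔ x ∉ A) : 4 ∣ Nat.card O := by
  classical
  have ha' : ∀ x, a (a x) = x := fun x => by
    rw [← Equiv.Perm.mul_apply, ha, Equiv.Perm.one_apply]
  have hb' : ∀ x, b (b x) = x := fun x => by
    rw [← Equiv.Perm.mul_apply, hb, Equiv.Perm.one_apply]
  have hsplit := Finset.card_filter_add_card_filter_not (s := O.toFinset) (fun x => x ∈ A)
  have hswap : (O.toFinset.filter (fun x => x ∈ A)).card
      = (O.toFinset.filter (fun x => ¬ x ∈ A)).card := by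
    refine Finset.card_bij' (fun x _ => b x) (fun x _ => b x) ?_ ?_ ?_ ?_
    · intro x hx
      simp only [Finset.mem_filter, Set.mem_toFinset] at hx ⊢
      exact ⟨hbO x hx.1, fun h => (hbA x).1 h hx.2⟩
    · intro x hx
      simp only [Finset.mem_filter, Set.mem_toFinset] at hx ⊢
      exact ⟨hbO x hx.1, (hbA x).2 hx.2⟩
    · exact fun x _ => hb' x
    · exact fun x _ => hb' x
  have heven : Even (O.toFinset.filter (fun x => x ∈ A)).card := by
    have hsum : ∑ x ∈ O.toFinset.filter (fun x => x ∈ A), (1 : ZMod 2) = 0 := by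
      refine Finset.sum_involution (fun x _ => a x) (fun _ _ => by decide)
        (fun x _ _ => hfa x) ?_ (fun x _ => ha' x)
      intro x hx
      simp only [Finset.mem_filter, Set.mem_toFinset] at hx ⊢
      exact ⟨haO x hx.1, (haA x).2 hx.2⟩
    rwa [Finset.sum_const, nsmul_one, ZMod.natCast_eq_zero_iff_even] at hsum
  have hcard : Nat.card O = O.toFinset.card := by
    rw [Nat.card_eq_fintype_card, Set.toFinset_card]
  obtain ⟨k, hk⟩ := heven
  omega

/-- The orbit of a point under the group generated by `S` is invariant under `S`. -/
theorem apply_mem_orbit_closure {F : Type} {S : Set (Equiv.Perm F)} {s : Equiv.Perm F}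
    (hs : s ∈ S) (x y : F) (hy : y ∈ MulAction.orbit (Subgroup.closure S) x) :
    s y ∈ MulAction.orbit (Subgroup.closure S) x :=
  MulAction.mem_orbit_of_mem_orbit (⟨s, Subgroup.subset_closure hs⟩ : Subgroup.closure S) hy

namespace CMap

variable {F : Type} [Fintype F]

theorem flagOrbit_eq_iff (M : CMap F) {x y : F} :
    M.flagOrbit x = M.flagOrbit y ↔ x ∈ M.flagOrbit y :=
  MulAction.orbit_eq_iff

theorem apply_mem_flagOrbit (M : CMap F) {s : Equiv.Perm F} (hs : s ∈ ({M.s0, M.s1, M.s2} : Set _))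
    {x y : F} (h : x ∈ M.flagOrbit y) : s x ∈ M.flagOrbit (s y) := by
  obtain ⟨g, rfl⟩ := h
  refine ⟨g, ?_⟩
  exact (DFunLike.congr_fun (Subgroup.mem_centralizer_iff.1 g.2 s hs) y).symm

/-- In a map with only two flag orbits, every generating involution either preserves both orbits
or exchanges them. -/
theorem preserves_or_swaps (M : CMap F) {x₀ y₀ : F}
    (hor : ∀ z, z ∈ M.flagOrbit x₀ ∨ z ∈ M.flagOrbit y₀)
    {s : Equiv.Perm F} (hs : s ∈ ({M.s0, M.s1, M.s2} : Set _)) (hinv : s * s = 1) :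
    (∀ z, s z ∈ M.flagOrbit x₀ ↔ z ∈ M.flagOrbit x₀) ∨
      (∀ z, s z ∈ M.flagOrbit x₀ ↔ z ∉ M.flagOrbit x₀) := by
  have hss : ∀ x, s (s x) = x := fun x => by
    rw [← Equiv.Perm.mul_apply, hinv, Equiv.Perm.one_apply]
  by_cases h : s x₀ ∈ M.flagOrbit x₀
  · left
    have key : ∀ z ∈ M.flagOrbit x₀, s z ∈ M.flagOrbit x₀ := fun z hz => by
      rw [← M.flagOrbit_eq_iff.2 h]
      exact M.apply_mem_flagOrbit hs hz
    exact fun z => ⟨fun hz => hss z ▸ key _ hz, key z⟩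
  · right
    refine fun z => ⟨fun hz hz' => h ?_, fun hz => ?_⟩
    · have h1 := M.flagOrbit_eq_iff.2 (M.apply_mem_flagOrbit hs hz')
      rw [← M.flagOrbit_eq_iff, ← h1, M.flagOrbit_eq_iff]
      exact hz
    · have h1 := M.flagOrbit_eq_iff.2 ((hor z).resolve_left hz)
      have h2 := M.flagOrbit_eq_iff.2 ((hor (s x₀)).resolve_left h)
      have h3 := M.apply_mem_flagOrbit hs (M.flagOrbit_eq_iff.1 (h1.trans h2.symm))
      rwa [hss] at h3

end CMap

/-- Every vertex-transitive equivelar map of Schläfli type `{3, 7}`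
that is a `2`-orbit map is chiral. -/
theorem stmt_6 {F : Type} [Fintype F] (M : CMap F)
    (heq : M.Equivelar 3 7) (hvt : M.VertexTransitive) (h2 : M.IsKOrbit 2) :
    M.IsChiral := by
  refine ⟨h2, ?_⟩
  obtain ⟨x₀, y₀, hne, hor⟩ : ∃ x₀ y₀, y₀ ∉ M.flagOrbit x₀ ∧
      ∀ z, z ∈ M.flagOrbit x₀ ∨ z ∈ M.flagOrbit y₀ := by
    have h : (Set.range M.flagOrbit).ncard = 2 := h2
    obtain ⟨A, B, hAB, hr⟩ := Set.ncard_eq_two.1 h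
    obtain ⟨x₀, rfl⟩ : A ∈ Set.range M.flagOrbit := by simp [hr]
    obtain ⟨y₀, rfl⟩ : B ∈ Set.range M.flagOrbit := by simp [hr]
    refine ⟨x₀, y₀, fun h => hAB (M.flagOrbit_eq_iff.2 h).symm, fun z => ?_⟩
    have hz : M.flagOrbit z ∈ Set.range M.flagOrbit := ⟨z, rfl⟩
    rw [hr] at hz
    exact hz.imp M.flagOrbit_eq_iff.1 M.flagOrbit_eq_iff.1
  have face {s : Equiv.Perm F} (hs : s ∈ ({M.s0, M.s1} : Set _)) :=
    apply_mem_orbit_closure hs x₀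
  have vert {s : Equiv.Perm F} (hs : s ∈ ({M.s1, M.s2} : Set _)) :=
    apply_mem_orbit_closure hs x₀
  have hface : ¬ 4 ∣ Nat.card (M.faceOf x₀) := by rw [heq.1]; norm_num
  have hvert : ¬ 4 ∣ Nat.card (M.vertexOf x₀) := by rw [heq.2]; norm_num
  have hswap : (∀ z, M.s0 z ∈ M.flagOrbit x₀ ↔ z ∉ M.flagOrbit x₀) ∧
      (∀ z, M.s1 z ∈ M.flagOrbit x₀ ↔ z ∉ M.flagOrbit x₀) ∧
      (∀ z, M.s2 z ∈ M.flagOrbit x₀ ↔ z ∉ M.flagOrbit x₀) := by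
    rcases M.preserves_or_swaps hor (s := M.s1) (by simp) M.invol1 with h1 | h1
    · rcases M.preserves_or_swaps hor (s := M.s0) (by simp) M.invol0 with h0 | h0
      · rcases M.preserves_or_swaps hor (s := M.s2) (by simp) M.invol2 with hs2 | hs2
        · obtain ⟨g, hg, hgy⟩ := M.conn x₀ y₀
          have hpres : ∀ z, g z ∈ M.flagOrbit x₀ ↔ z ∈ M.flagOrbit x₀ := by
            clear hgy
            induction hg using Subgroup.closure_induction with
            | mem s hs => rcases hs with rfl | rfl | rfl <;> assumption
            | one => simp
            | mul a b _ _ ha hb => exact fun z => (ha (b z)).trans (hb z)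
            | inv a _ ha =>
              intro z
              rw [← ha (a⁻¹ z), ← Equiv.Perm.mul_apply, mul_inv_cancel, Equiv.Perm.one_apply]
          exact absurd (hgy ▸ (hpres x₀).2 (M.flagOrbit_eq_iff.1 rfl)) hne
        · exact absurd (four_dvd_card_of_preserves_of_swaps _ _ _ _ M.invol1 M.fpf1 M.invol2
            (vert (by simp)) (vert (by simp)) h1 hs2) hvert
      · exact absurd (four_dvd_card_of_preserves_of_swaps _ _ _ _ M.invol1 M.fpf1 M.invol0
          (face (by simp)) (face (by simp)) h1 h0) hface
    · refine ⟨?_, h1, ?_⟩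
      · refine (M.preserves_or_swaps hor (by simp) M.invol0).resolve_left fun h0 => hface ?_
        exact four_dvd_card_of_preserves_of_swaps _ _ _ _ M.invol0 M.fpf0 M.invol1
          (face (by simp)) (face (by simp)) h0 h1
      · refine (M.preserves_or_swaps hor (by simp) M.invol2).resolve_left fun hs2 => hvert ?_
        exact four_dvd_card_of_preserves_of_swaps _ _ _ _ M.invol2 M.fpf2 M.invol1
          (vert (by simp)) (vert (by simp)) hs2 h1
  have hnot : ∀ s : Equiv.Perm F, (∀ z, s z ∈ M.flagOrbit x₀ ↔ z ∉ M.flagOrbit x₀) →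
      ∀ x, s x ∉ M.flagOrbit x := by
    intro s hs x hx
    have h := hs x
    rw [← M.flagOrbit_eq_iff, M.flagOrbit_eq_iff.2 hx, M.flagOrbit_eq_iff] at h
    tauto
  exact fun x => ⟨hnot _ hswap.1 x, hnot _ hswap.2.1 x, hnot _ hswap.2.2 x⟩
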